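/- (Abstract matrix-tree theorem for codimension-1 minors.) For all i, j ∈ {1,…,n}, the Laplace operator applied to the universal (i,j)-minor satisfies Δ(det_{n,k}^{i/j}) = ((−1)^n / k!) · U(AC_{n,k}^{{i}}) in Graph_{n,k}; in particular the result is independent of j. -/

import Mathlib

open Finset

open scoped Classical Nat

noncomputable section

/-- A directed graph with `n` labeled vertices and `k` labeled edges:
the `ℓ`-th edge is the ordered pair `G ℓ = (a, b)` (an edge from `a` to `b`; loops allowed). -/
abbrev DG (n k : ℕ) := Fin k → Fin n × Fin n

namespace DG

variable {n k : ℕ}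

/-- `step G S a b`: the subgraph of `G` with edge-label set `S` has an edge from `a` to `b`. -/
def step (G : DG n k) (S : Finset (Fin k)) (a b : Fin n) : Prop :=
  ∃ e ∈ S, G e = (a, b)

/-- The subgraph of `G` with edge-label set `S` contains no directed cycle. -/
def Acyclic (G : DG n k) (S : Finset (Fin k)) : Prop :=
  ∀ a : Fin n, ¬ Relation.TransGen (step G S) a a

/-- The edge `e` lies on a directed cycle of the subgraph of `G` with edge set `S`
(equivalently, there is a directed path from the head of `e` back to its tail). -/
def OnCycle (G : DG n k) (S : Finset (Fin k)) (e : Fin k) : Prop :=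
  Relation.ReflTransGen (step G S) (G e).2 (G e).1

/-- Strongly semiconnected: every edge lies on a directed cycle. -/
def SSC (G : DG n k) (S : Finset (Fin k)) : Prop :=
  ∀ e ∈ S, OnCycle G S e

/-- Strongly connected: every ordered pair of vertices is joined by a directed path. -/
def StronglyConnected (G : DG n k) (S : Finset (Fin k)) : Prop :=
  ∀ a b : Fin n, Relation.ReflTransGen (step G S) a b

/-- Adjacency in the underlying undirected graph. -/
def adj (G : DG n k) (S : Finset (Fin k)) (a b : Fin n) : Prop :=
  ∃ e ∈ S, G e = (a, b) ∨ G e = (b, a)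

/-- `β₀`: the number of connected components of the underlying undirected graph
(isolated vertices count as components). -/
def beta0 (G : DG n k) (S : Finset (Fin k)) : ℕ :=
  Nat.card (Quot (adj G S))

/-- `α(H) = (−1)^{#edges}` if `H` is acyclic, `0` otherwise. -/
def alpha (G : DG n k) (S : Finset (Fin k)) : ℤ :=
  if Acyclic G S then (-1) ^ S.card else 0

/-- `σ(H) = (−1)^{β₁}` if `H` is strongly semiconnected, `0` otherwise;
here `β₁ = #edges − n + β₀`, and `(−1)^{#edges − n + β₀} = (−1)^{#edges + n + β₀}`. -/
def sigma (G : DG n k) (S : Finset (Fin k)) : ℤ :=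
  if SSC G S then (-1) ^ (S.card + n + beta0 G S) else 0

/-- The vertex `v` is isolated: incident to no edge. -/
def isolated (G : DG n k) (v : Fin n) : Prop :=
  ∀ e : Fin k, (G e).1 ≠ v ∧ (G e).2 ≠ v

/-- The vertex `v` is a sink: no edge starts at it. -/
def isSink (G : DG n k) (v : Fin n) : Prop :=
  ∀ e : Fin k, (G e).1 ≠ v

end DG
/-- `Graph_{n,k}`: the vector space over `R` with basis `Γ_{n,k}`. -/
abbrev GS (R : Type*) [Semiring R] (n k : ℕ) := DG n k →₀ R

namespace DG

variable {R : Type*}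

/-- Action of the operator `B_p` on a basis graph `G`: identity if the `p`-th edge is not a
loop, and `−∑_{b ≠ a} R_{ab;p} G` if it is the loop `[aa]`. -/
noncomputable def Bsingle [CommRing R] (n k : ℕ) (p : Fin k) (G : DG n k) : GS R n k :=
  if (G p).1 = (G p).2 then
    - ∑ b ∈ Finset.univ.filter (fun b => b ≠ (G p).1),
        Finsupp.single (Function.update G p ((G p).1, b)) (1 : R)
  else Finsupp.single G 1

/-- The linear operator `B_p : Graph_{n,k} → Graph_{n,k}`. -/
noncomputable def B [CommRing R] (n k : ℕ) (p : Fin k) : GS R n k →ₗ[R] GS R n k :=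
  Finsupp.lsum R fun G => LinearMap.toSpanSingleton R (GS R n k) (Bsingle n k p G)

/-- The Laplace operator `Δ = B_1 ⋯ B_k` (identity when `k = 0`). -/
noncomputable def Laplace [CommRing R] (n k : ℕ) : GS R n k →ₗ[R] GS R n k :=
  (List.ofFn fun p : Fin k => B (R := R) n k p).prod

/-- `U(𝔅) = ∑_{G ∈ 𝔅} G`. -/
noncomputable def U (R : Type*) [CommRing R] (n k : ℕ) (P : DG n k → Prop) : GS R n k :=
  ∑ G : DG n k, if P G then Finsupp.single G (1 : R) else 0

/-- `X(𝔅) = ∑_{G ∈ 𝔅} (−1)^{β₀(G)} G`. -/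
noncomputable def X (R : Type*) [CommRing R] (n k : ℕ) (P : DG n k → Prop) : GS R n k :=
  ∑ G : DG n k, if P G then Finsupp.single G ((-1 : R) ^ beta0 G Finset.univ) else 0

/-- `SSC_{n,k}^I`: strongly semiconnected graphs whose set of isolated vertices is exactly `I`. -/
def SSCset (n k : ℕ) (I : Finset (Fin n)) : DG n k → Prop :=
  fun G => SSC G Finset.univ ∧ {v | isolated G v} = (I : Set (Fin n))

/-- `AC_{n,k}^I`: acyclic graphs whose set of sinks is exactly `I`. -/
def ACset (n k : ℕ) (I : Finset (Fin n)) : DG n k → Prop :=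
  fun G => Acyclic G Finset.univ ∧ {v | isSink G v} = (I : Set (Fin n))

/-- The universal diagonal `I`-minor `det_{n,k}^I = ((−1)^k / k!) · X(SSC_{n,k}^I)`. -/
noncomputable def detI (R : Type*) [Field R] (n k : ℕ) (I : Finset (Fin n)) : GS R n k :=
  (((-1 : R) ^ k) / (k ! : R)) • X R n k (SSCset n k I)

/-- The universal `(i,j)`-minor
`det_{n,k}^{i/j} = ((−1)^k / k!) · X({G : ([ij])*G ∈ SSC_{n,k+1}^∅})`. -/
noncomputable def detIJ (R : Type*) [Field R] (n k : ℕ) (i j : Fin n) : GS R n k :=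
  (((-1 : R) ^ k) / (k ! : R)) •
    X R n k (fun G => SSCset n (k + 1) (∅ : Finset (Fin n)) (Fin.cons (i, j) G))

/-- The pairing `⟨W | G⟩ = ∏_{[ij] ∈ G} w_{ij}`, extended linearly to `Graph_{n,k}`. -/
noncomputable def pair [CommRing R] {n k : ℕ} (W : Matrix (Fin n) (Fin n) R)
    (x : GS R n k) : R :=
  x.sum fun G c => c * ∏ e : Fin k, W (G e).1 (G e).2

/-- The Laplace matrix `Ŵ` of `W`: off-diagonal entries `w_{ij}`, diagonal entries
`−∑_{j ≠ i} w_{ij}`. -/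
def lapMat [CommRing R] {n : ℕ} (W : Matrix (Fin n) (Fin n) R) : Matrix (Fin n) (Fin n) R :=
  Matrix.of fun i j =>
    if i = j then - ∑ l ∈ Finset.univ.filter (fun l => l ≠ i), W i l else W i j

end DG

namespace DG

variable {n k : ℕ}

lemma step_mono (G : DG n k) {S T : Finset (Fin k)} (h : S ⊆ T) {a b : Fin n}
    (hab : step G S a b) : step G T a b := by
  obtain ⟨e, he, h'⟩ := hab
  exact ⟨e, h he, h'⟩

lemma reflTransGen_step_mono (G : DG n k) {S T : Finset (Fin k)} (h : S ⊆ T) {a b : Fin n}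
    (hab : Relation.ReflTransGen (step G S) a b) : Relation.ReflTransGen (step G T) a b :=
  Relation.ReflTransGen.mono (fun _ _ => step_mono G h) _ _ hab

lemma Acyclic.mono {G : DG n k} {S T : Finset (Fin k)} (h : S ⊆ T) (hT : Acyclic G T) :
    Acyclic G S :=
  fun a ha => hT a (Relation.TransGen.mono (fun _ _ => step_mono G h) _ _ ha)

lemma acyclic_empty (G : DG n k) : Acyclic G ∅ := by
  intro a ha
  obtain ⟨b, ⟨e, he, -⟩, -⟩ := Relation.TransGen.head'_iff.1 ha
  simp at he

/-- A path that may use the extra edge `e` either avoids it, or reaches its tail and, after its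
last use, continues from its head without it. -/
lemma reflTransGen_insert {G : DG n k} {S : Finset (Fin k)} {e : Fin k} {a b : Fin n}
    (h : Relation.ReflTransGen (step G (insert e S)) a b) :
    Relation.ReflTransGen (step G S) a b ∨
      Relation.ReflTransGen (step G S) a (G e).1 ∧ Relation.ReflTransGen (step G S) (G e).2 b := by
  induction h with
  | refl => exact Or.inl .refl
  | tail _ hbc ih =>
    obtain ⟨f, hf, hfe⟩ := hbc
    rcases Finset.mem_insert.1 hf with rfl | hf
    · rcases ih with ih | ⟨ih, -⟩
      · right
        rw [hfe]
        exact ⟨ih, .refl⟩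
      · right
        refine ⟨ih, ?_⟩
        rw [hfe]
    · rcases ih with ih | ⟨ih, ih'⟩
      · exact Or.inl (ih.tail ⟨f, hf, hfe⟩)
      · exact Or.inr ⟨ih, ih'.tail ⟨f, hf, hfe⟩⟩

lemma onCycle_insert_self {G : DG n k} {S : Finset (Fin k)} {e : Fin k} :
    OnCycle G (insert e S) e ↔ Relation.ReflTransGen (step G S) (G e).2 (G e).1 := by
  refine ⟨fun h => ?_, fun h => reflTransGen_step_mono G (Finset.subset_insert e S) h⟩
  rcases reflTransGen_insert h with h | h
  · exact h
  · exact h.1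

lemma acyclic_insert_iff {G : DG n k} {S : Finset (Fin k)} {e : Fin k} :
    Acyclic G (insert e S) ↔
      Acyclic G S ∧ ¬ Relation.ReflTransGen (step G S) (G e).2 (G e).1 := by
  constructor
  · refine fun h => ⟨h.mono (Finset.subset_insert e S), fun hc => h (G e).1 ?_⟩
    exact Relation.TransGen.head' ⟨e, Finset.mem_insert_self e S, rfl⟩
      (reflTransGen_step_mono G (Finset.subset_insert e S) hc)
  · rintro ⟨hS, hc⟩ a ha
    obtain ⟨b, ⟨f, hf, hfe⟩, hba⟩ := Relation.TransGen.head'_iff.1 ha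
    rcases reflTransGen_insert hba with h | ⟨h, h'⟩
    · rcases Finset.mem_insert.1 hf with rfl | hf
      · apply hc
        rw [hfe]
        exact h
      · exact hS a (Relation.TransGen.head' ⟨f, hf, hfe⟩ h)
    · rcases Finset.mem_insert.1 hf with rfl | hf
      · apply hc
        rw [hfe] at h ⊢
        exact h
      · exact hc (h'.trans (Relation.ReflTransGen.head ⟨f, hf, hfe⟩ h))

lemma Acyclic.exists_sink {G : DG n k} {S : Finset (Fin k)} (hS : Acyclic G S)
    {c : Finset (Fin n)} (hc : c.Nonempty) (hcl : ∀ e ∈ S, (G e).1 ∈ c → (G e).2 ∈ c) :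
    ∃ v ∈ c, ∀ e ∈ S, (G e).1 ≠ v := by
  have hwf : WellFounded (fun a b => Relation.TransGen (step G S) b a) := by
    have : IsTrans (Fin n) (fun a b => Relation.TransGen (step G S) b a) :=
      ⟨fun _ _ _ h h' => h'.trans h⟩
    have : Std.Irrefl (fun a b => Relation.TransGen (step G S) b a) := ⟨hS⟩
    exact Finite.wellFounded_of_trans_of_irrefl _
  obtain ⟨v, hv, hmin⟩ := hwf.has_min (c : Set (Fin n)) (by simpa using hc)
  refine ⟨v, hv, ?_⟩
  rintro e he rfl
  exact hmin _ (hcl e he hv) (.single ⟨e, he, rfl⟩)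

lemma sum_powerset_toggle {ι : Type*} [DecidableEq ι] {E : Finset ι} {e : ι} (he : e ∈ E)
    {P : Finset ι → Prop} [DecidablePred P] (hP : ∀ S ⊆ E, e ∉ S → (P (insert e S) ↔ P S)) :
    ∑ S ∈ E.powerset, (if P S then (-1 : ℤ) ^ S.card else 0) = 0 := by
  rw [← Finset.insert_erase he, Finset.sum_powerset_insert (Finset.notMem_erase e E),
    ← Finset.sum_add_distrib]
  refine Finset.sum_eq_zero fun S hS => ?_
  have hS' := Finset.mem_powerset.1 hS
  have heS : e ∉ S := fun h => Finset.notMem_erase e E (hS' h)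
  rw [if_congr (hP S (hS'.trans (Finset.erase_subset e E)) heS) rfl rfl,
    Finset.card_insert_of_notMem heS]
  split_ifs <;> ring

/-- The signed count of the nonempty sets of sinks. -/
lemma sum_powerset_nonempty_disjoint {V : Type*} {c : Finset V} {Q : V → Prop} [DecidablePred Q]
    (h : ∃ v ∈ c, Q v) :
    ∑ W ∈ c.powerset, (if W.Nonempty ∧ ∀ v ∈ W, Q v then (-1 : ℤ) ^ (W.card + 1) else 0) = 1 := by
  have hne : (c.filter Q).Nonempty := by
    obtain ⟨v, hv, hq⟩ := h
    exact ⟨v, by simp [hv, hq]⟩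
  have h0 := Finset.sum_powerset_neg_one_pow_card_of_nonempty hne
  rw [← Finset.add_sum_erase _ _ (Finset.empty_mem_powerset _)] at h0
  rw [← Finset.sum_filter]
  have : c.powerset.filter (fun W => W.Nonempty ∧ ∀ v ∈ W, Q v)
      = (c.filter Q).powerset.erase ∅ := by
    ext W
    simp only [Finset.mem_filter, Finset.mem_powerset, Finset.mem_erase,
      Finset.subset_iff, Finset.nonempty_iff_ne_empty, ne_eq]
    grind
  rw [this]
  simp only [pow_succ, ← Finset.sum_mul]
  simp only [Finset.card_empty, pow_zero] at h0
  linarith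

lemma exists_step_into {G : DG n k} {E : Finset (Fin k)} {W : Finset (Fin n)} {a b : Fin n}
    (h : Relation.ReflTransGen (step G E) a b) (ha : a ∉ W) (hb : b ∈ W) :
    ∃ e ∈ E, (G e).1 ∉ W ∧ (G e).2 ∈ W := by
  induction h with
  | refl => exact absurd hb ha
  | @tail x y _ hxy ih =>
    by_cases hx : x ∈ W
    · exact ih hx
    · obtain ⟨e, he, hxe⟩ := hxy
      exact ⟨e, he, by simp [hxe, hx], by simp [hxe, hb]⟩

/-- Stripping a strongly connected, out-closed vertex set `c` of its edges multiplies the signed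
count of acyclic subgraphs by `(−1)^{|c| + 1}`. -/
lemma sum_acyclic_strip {G : DG n k} {E : Finset (Fin k)} {c : Finset (Fin n)}
    (hc : c.Nonempty) (hcl : ∀ e ∈ E, (G e).1 ∈ c → (G e).2 ∈ c)
    (hconn : ∀ a ∈ c, ∀ b ∈ c, Relation.ReflTransGen (step G E) a b) :
    ∑ S ∈ E.powerset, (if Acyclic G S then (-1 : ℤ) ^ S.card else 0)
      = (-1) ^ (c.card + 1) *
        ∑ S ∈ (E.filter fun e => (G e).1 ∉ c).powerset,
          (if Acyclic G S then (-1 : ℤ) ^ S.card else 0) := by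
  have key : ∀ S ∈ E.powerset, (if Acyclic G S then (-1 : ℤ) ^ S.card else 0)
      = ∑ W ∈ c.powerset, (if W.Nonempty then (-1 : ℤ) ^ (W.card + 1) else 0) *
        (if Acyclic G S ∧ ∀ v ∈ W, ∀ e ∈ S, (G e).1 ≠ v then (-1 : ℤ) ^ S.card else 0) := by
    intro S hS
    by_cases hA : Acyclic G S
    · have h1 := sum_powerset_nonempty_disjoint
        (hA.exists_sink hc fun e he => hcl e (Finset.mem_powerset.1 hS he))
      simp only [hA, if_true, true_and]
      have h2 := congrArg (fun x : ℤ => x * (-1) ^ S.card) h1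
      simp only [one_mul, Finset.sum_mul] at h2
      refine h2.symm.trans (Finset.sum_congr rfl fun W _ => ?_)
      by_cases h3 : W.Nonempty <;>
        simp [h3]
    · simp [hA]
  rw [Finset.sum_congr rfl key, Finset.sum_comm, Finset.sum_eq_single c]
  · rw [if_pos hc, ← Finset.mul_sum]
    congr 1
    rw [← Finset.sum_filter, ← Finset.sum_filter]
    refine Finset.sum_congr ?_ fun _ _ => rfl
    ext S
    simp only [Finset.mem_filter, Finset.mem_powerset, Finset.subset_iff]
    grind
  · intro W hW hWc
    rw [← Finset.mul_sum]
    by_cases hne : W.Nonempty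
    · have hWc' := Finset.mem_powerset.1 hW
      obtain ⟨w, hw⟩ := hne
      obtain ⟨a, ha, haW⟩ : ∃ a ∈ c, a ∉ W := by
        by_contra! hcon
        exact hWc (Finset.Subset.antisymm hWc' hcon)
      obtain ⟨e, he, he1, he2⟩ := exists_step_into (hconn a ha w (hWc' hw)) haW hw
      rw [sum_powerset_toggle (P := fun S => Acyclic G S ∧ ∀ v ∈ W, ∀ e ∈ S, (G e).1 ≠ v) he,
        mul_zero]
      intro S _ _
      constructor
      · rintro ⟨h1, h2⟩
        exact ⟨h1.mono (Finset.subset_insert e S), fun v hv f hf =>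
          h2 v hv f (Finset.mem_insert_of_mem hf)⟩
      · rintro ⟨h1, h2⟩
        refine ⟨acyclic_insert_iff.2 ⟨h1, fun hp => ?_⟩, fun v hv f hf => ?_⟩
        · rcases Relation.ReflTransGen.cases_head hp with h | ⟨x, ⟨f, hf, hfx⟩, -⟩
          · exact he1 (h ▸ he2)
          · exact h2 _ he2 f hf (by rw [hfx])
        · rcases Finset.mem_insert.1 hf with rfl | hf
          · rintro rfl
            exact he1 hv
          · exact h2 v hv f hf
    · simp [hne]
  · simp

lemma SSC.reflTransGen_symm {G : DG n k} {E : Finset (Fin k)} (hE : SSC G E) {a b : Fin n}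
    (h : step G E a b) : Relation.ReflTransGen (step G E) b a := by
  obtain ⟨e, he, hab⟩ := h
  have := hE e he
  rwa [OnCycle, hab] at this

lemma SSC.reflTransGen_of_mk_eq {G : DG n k} {E : Finset (Fin k)} (hE : SSC G E) {a b : Fin n}
    (h : Quot.mk (adj G E) a = Quot.mk (adj G E) b) :
    Relation.ReflTransGen (step G E) a b := by
  have h' := Quot.eqvGen_exact h
  have : ∀ x y, Relation.EqvGen (adj G E) x y →
      Relation.ReflTransGen (step G E) x y ∧ Relation.ReflTransGen (step G E) y x := by
    intro x y hxy
    induction hxy with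
    | rel x y hxy =>
      obtain ⟨e, he, h | h⟩ := hxy
      · exact ⟨.single ⟨e, he, h⟩, hE.reflTransGen_symm ⟨e, he, h⟩⟩
      · exact ⟨hE.reflTransGen_symm ⟨e, he, h⟩, .single ⟨e, he, h⟩⟩
    | refl => exact ⟨.refl, .refl⟩
    | symm _ _ _ ih => exact ih.symm
    | trans _ _ _ _ _ ih ih' => exact ⟨ih.1.trans ih'.1, ih'.2.trans ih.2⟩
  exact (this a b h').1

lemma mk_adj_eq {G : DG n k} {E : Finset (Fin k)} {e : Fin k} (he : e ∈ E) :
    Quot.mk (adj G E) (G e).1 = Quot.mk (adj G E) (G e).2 :=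
  Quot.sound ⟨e, he, Or.inl rfl⟩

lemma reflTransGen_filter {G : DG n k} {E : Finset (Fin k)} (D : Finset (Quot (adj G E)))
    {a b : Fin n} (ha : Quot.mk (adj G E) a ∉ D) (h : Relation.ReflTransGen (step G E) a b) :
    Relation.ReflTransGen (step G (E.filter fun e => Quot.mk (adj G E) (G e).1 ∉ D)) a b := by
  suffices h' : Quot.mk (adj G E) b = Quot.mk (adj G E) a ∧ Relation.ReflTransGen
      (step G (E.filter fun e => Quot.mk (adj G E) (G e).1 ∉ D)) a b from h'.2
  induction h with
  | refl => exact ⟨rfl, .refl⟩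
  | tail _ hxy ih =>
    obtain ⟨e, he, hxe⟩ := hxy
    have hm := mk_adj_eq (G := G) he
    refine ⟨?_, ih.2.tail ⟨e, ?_, hxe⟩⟩
    · rw [hxe] at hm
      exact hm.symm.trans ih.1
    · simp [he, hxe, ih.1, ha]

lemma SSC.sum_acyclic {G : DG n k} {E : Finset (Fin k)} (hE : SSC G E) :
    ∑ S ∈ E.powerset, (if Acyclic G S then (-1 : ℤ) ^ S.card else 0)
      = (-1) ^ (n + beta0 G E) := by
  let _ : Fintype (Quot (adj G E)) := Fintype.ofFinite _
  let fiber : Quot (adj G E) → Finset (Fin n) :=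
    fun q => Finset.univ.filter fun v => Quot.mk (adj G E) v = q
  have key : ∀ D : Finset (Quot (adj G E)),
      ∑ S ∈ E.powerset, (if Acyclic G S then (-1 : ℤ) ^ S.card else 0)
        = (∏ q ∈ D, (-1) ^ ((fiber q).card + 1)) *
          ∑ S ∈ (E.filter fun e => Quot.mk (adj G E) (G e).1 ∉ D).powerset,
            (if Acyclic G S then (-1 : ℤ) ^ S.card else 0) := by
    intro D
    induction D using Finset.induction_on with
    | empty => simp
    | insert q D hq ih =>
      rw [ih, Finset.prod_insert hq, sum_acyclic_strip (c := fiber q)]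
      · have : ((E.filter fun e => Quot.mk (adj G E) (G e).1 ∉ D).filter
            fun e => (G e).1 ∉ fiber q)
            = E.filter fun e => Quot.mk (adj G E) (G e).1 ∉ insert q D := by
          ext e
          simp [fiber]
          tauto
        rw [this]
        ring
      · obtain ⟨v, rfl⟩ := Quot.exists_rep q
        exact ⟨v, by simp [fiber]⟩
      · intro e he h
        simp only [fiber, Finset.mem_filter, Finset.mem_univ, true_and] at he h ⊢
        rw [← mk_adj_eq he.1, h]
      · intro a ha b hb
        simp only [fiber, Finset.mem_filter, Finset.mem_univ, true_and] at ha hb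
        exact reflTransGen_filter D (ha ▸ hq) (hE.reflTransGen_of_mk_eq (ha.trans hb.symm))
  rw [key Finset.univ]
  have hn : ∑ q, (fiber q).card = n := by
    have := Finset.card_eq_sum_card_fiberwise (s := (Finset.univ : Finset (Fin n)))
      (f := Quot.mk (adj G E)) (t := Finset.univ) (fun _ _ => Finset.mem_coe.2 (Finset.mem_univ _))
    rw [Finset.card_univ, Fintype.card_fin] at this
    convert this.symm
  rw [Finset.prod_pow_eq_pow_sum, Finset.sum_add_distrib, hn]
  simp [acyclic_empty, beta0]

lemma sum_acyclic (G : DG n k) (E : Finset (Fin k)) :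
    ∑ S ∈ E.powerset, (if Acyclic G S then (-1 : ℤ) ^ S.card else 0)
      = if SSC G E then (-1) ^ (n + beta0 G E) else 0 := by
  split_ifs with hE
  · exact hE.sum_acyclic
  · obtain ⟨e, he, hc⟩ : ∃ e ∈ E, ¬ OnCycle G E e := by
      simpa [SSC] using hE
    refine sum_powerset_toggle he fun S hS _ => ?_
    rw [acyclic_insert_iff]
    exact and_iff_left fun h => hc (reflTransGen_step_mono G hS h)

lemma sum_powerset_moebius {ι : Type*} [DecidableEq ι] (E : Finset ι) (f : Finset ι → ℤ) :
    ∑ T ∈ E.powerset, (-1 : ℤ) ^ T.card * ∑ S ∈ T.powerset, f S = (-1) ^ E.card * f E := by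
  induction E using Finset.induction_on generalizing f with
  | empty => simp
  | insert e E he ih =>
    rw [Finset.sum_powerset_insert he, Finset.card_insert_of_notMem he]
    have : ∀ T ∈ E.powerset,
        (-1 : ℤ) ^ (insert e T).card * ∑ S ∈ (insert e T).powerset, f S
          = - ((-1 : ℤ) ^ T.card * ∑ S ∈ T.powerset, f S)
            - (-1 : ℤ) ^ T.card * ∑ S ∈ T.powerset, f (insert e S) := by
      intro T hT
      have heT : e ∉ T := fun h => he (Finset.mem_powerset.1 hT h)
      rw [Finset.sum_powerset_insert heT, Finset.card_insert_of_notMem heT]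
      ring
    rw [Finset.sum_congr rfl this, Finset.sum_sub_distrib, Finset.sum_neg_distrib,
      ih (fun S => f (insert e S))]
    ring

/-- The signed count of strongly semiconnected subgraphs detects acyclicity. -/
lemma sum_SSC (G : DG n k) (E : Finset (Fin k)) :
    ∑ T ∈ E.powerset, sigma G T = if Acyclic G E then 1 else 0 := by
  have h := sum_powerset_moebius E (fun S => if Acyclic G S then (-1 : ℤ) ^ S.card else 0)
  simp only [sum_acyclic] at h
  calc _ = _ := Finset.sum_congr rfl fun T _ => by
        rw [sigma]
        show _ = (-1 : ℤ) ^ T.card * if SSC G T then (-1) ^ (n + beta0 G T) else 0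
        rw [mul_ite, mul_zero, ← pow_add, add_assoc]
    _ = _ := h
    _ = _ := by
      rw [mul_ite, mul_zero, ← pow_add, ← two_mul, pow_mul]
      simp

lemma card_quot_congr {V : Type*} {r s : V → V → Prop}
    (hrs : ∀ a b, r a b → Relation.EqvGen s a b) (hsr : ∀ a b, s a b → Relation.EqvGen r a b) :
    Nat.card (Quot r) = Nat.card (Quot s) :=
  Nat.card_congr
    { toFun := Quot.lift (Quot.mk s) fun a b h => Quot.eqvGen_sound (hrs a b h)
      invFun := Quot.lift (Quot.mk r) fun a b h => Quot.eqvGen_sound (hsr a b h)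
      left_inv := by rintro ⟨a⟩; rfl
      right_inv := by rintro ⟨a⟩; rfl }

lemma eqvGen_of_reflTransGen {G : DG n k} {S : Finset (Fin k)} {a b : Fin n}
    (h : Relation.ReflTransGen (step G S) a b) : Relation.EqvGen (adj G S) a b := by
  induction h with
  | refl => exact .refl _
  | tail _ hxy ih =>
    obtain ⟨e, he, h⟩ := hxy
    exact ih.trans _ _ _ (.rel _ _ ⟨e, he, Or.inl h⟩)

lemma beta0_insert_of_onCycle {G : DG n k} {T : Finset (Fin k)} {e : Fin k}
    (h : OnCycle G (insert e T) e) : beta0 G (insert e T) = beta0 G T := by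
  have hc := eqvGen_of_reflTransGen (onCycle_insert_self.1 h)
  refine card_quot_congr ?_ ?_
  · rintro a b ⟨f, hf, hab⟩
    rcases Finset.mem_insert.1 hf with rfl | hf
    · rcases hab with hab | hab <;> rw [hab] at hc
      · exact hc.symm
      · exact hc
    · exact .rel _ _ ⟨f, hf, hab⟩
  · rintro a b ⟨f, hf, hab⟩
    exact .rel _ _ ⟨f, Finset.mem_insert_of_mem hf, hab⟩

/-- The signed count of the subgraphs that become strongly semiconnected with the edge `e`. -/
lemma sum_SSC_insert (G : DG n k) {E : Finset (Fin k)} {e : Fin k} (he : e ∉ E) :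
    ∑ T ∈ E.powerset,
        (if SSC G (insert e T) then (-1 : ℤ) ^ (T.card + n + beta0 G T) else 0)
      = (if Acyclic G E then 1 else 0) - if Acyclic G (insert e E) then 1 else 0 := by
  rw [← sum_SSC, ← sum_SSC, Finset.sum_powerset_insert he, ← sub_sub, sub_self, zero_sub,
    ← Finset.sum_neg_distrib]
  refine Finset.sum_congr rfl fun T hT => ?_
  have heT : e ∉ T := fun h => he (Finset.mem_powerset.1 hT h)
  rw [sigma]
  split_ifs with hs
  · rw [beta0_insert_of_onCycle (hs e (Finset.mem_insert_self e T)),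
      Finset.card_insert_of_notMem heT]
    ring
  · simp

lemma B_single {R : Type*} [CommRing R] (p : Fin k) (G : DG n k) (c : R) :
    B n k p (Finsupp.single G c) = c • Bsingle n k p G := by
  simp [B]

lemma B_apply {R : Type*} [CommRing R] (p : Fin k) (x : GS R n k) (H : DG n k) :
    B n k p x H = if (H p).1 = (H p).2 then 0
      else x H - x (Function.update H p ((H p).1, (H p).1)) := by
  induction x using Finsupp.induction_linear with
  | zero => simp
  | add x y hx hy =>
    simp only [map_add, Finsupp.add_apply, hx, hy]
    split_ifs <;> ring
  | single G c =>
    rw [B_single, Bsingle]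
    simp only [Finsupp.smul_apply, smul_eq_mul, Finsupp.single_apply]
    by_cases hG : (G p).1 = (G p).2
    · have hne : ¬ (H p).1 = (H p).2 → G ≠ H := by
        rintro h rfl
        exact h hG
      have hupd : ∀ b, Function.update G p ((G p).1, b) = H ↔
          G = Function.update H p ((H p).1, (H p).1) ∧ b = (H p).2 := by
        intro b
        simp only [Function.update_eq_iff, Function.eq_update_iff, Prod.ext_iff]
        grind
      simp only [hG, if_true, Finsupp.neg_apply, Finsupp.finsetSum_apply, Finsupp.single_apply]
      rw [← hG]
      simp only [hupd]
      split_ifs with h1 h2 h3 h3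
      · rw [Finset.sum_eq_zero]
        · simp
        · intro b hb
          rw [if_neg]
          rintro ⟨h, rfl⟩
          have : (G p).1 = (H p).1 := by rw [h]; simp
          simp [this, h1] at hb
      · exact absurd h2 (hne h1)
      · exact absurd h2 (hne h1)
      · have : (G p).1 = (H p).1 := by rw [h3]; simp
        rw [Finset.sum_eq_single (H p).2]
        · simp [h3]
        · intro b _ hb
          rw [if_neg]
          exact fun h => hb h.2
        · intro h
          simp [this, Ne.symm h1] at h
      · rw [Finset.sum_eq_zero]
        · simp
        · intro b _
          rw [if_neg]
          exact fun h => h3 h.1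
    · have hne : G ≠ Function.update H p ((H p).1, (H p).1) := by
        rintro rfl
        simp at hG
      rw [if_neg hG, if_neg hne, sub_zero, Finsupp.single_apply]
      split_ifs with h1 h2
      · subst h1
        exact absurd h2 hG
      all_goals simp

/-- Replace the edges of `G` with labels in `S` by loops at their tails. -/
def loopify (G : DG n k) (S : Finset (Fin k)) : DG n k :=
  fun p => if p ∈ S then ((G p).1, (G p).1) else G p

lemma loopify_update (G : DG n k) (S : Finset (Fin k)) (p : Fin k) :
    loopify (Function.update G p ((G p).1, (G p).1)) S = loopify G (insert p S) := by
  funext q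
  by_cases hq : q = p
  · subst hq
    simp [loopify]
  · simp [loopify, hq]

lemma prod_B_apply {R : Type*} [CommRing R] (l : List (Fin k)) (hl : l.Nodup) (x : GS R n k)
    (H : DG n k) :
    (l.map fun p => B (R := R) n k p).prod x H
      = if ∃ p ∈ l, (H p).1 = (H p).2 then 0
        else ∑ S ∈ l.toFinset.powerset, (-1 : R) ^ S.card * x (loopify H S) := by
  induction l generalizing H with
  | nil =>
    have : loopify H ∅ = H := by
      funext p
      simp [loopify]
    simp [this]
  | cons p l ih =>
    obtain ⟨hp, hl⟩ := List.nodup_cons.1 hl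
    have hp' : p ∉ l.toFinset := by simpa using hp
    rw [List.map_cons, List.prod_cons, Module.End.mul_apply, B_apply, ih hl, ih hl]
    have hu : (∃ q ∈ l, (Function.update H p ((H p).1, (H p).1) q).1
          = (Function.update H p ((H p).1, (H p).1) q).2)
        ↔ ∃ q ∈ l, (H q).1 = (H q).2 := by
      refine exists_congr fun q => and_congr_right fun hq => ?_
      rw [Function.update_of_ne (by rintro rfl; exact hp hq)]
    rw [if_congr hu rfl rfl, List.toFinset_cons, Finset.sum_powerset_insert hp']
    simp only [List.mem_cons, exists_eq_or_imp, loopify_update]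
    by_cases h1 : (H p).1 = (H p).2
    · simp [h1]
    by_cases h2 : ∃ q ∈ l, (H q).1 = (H q).2
    · simp [h1, h2]
    · rw [if_neg h1, if_neg h2, if_neg h2, if_neg (not_or.2 ⟨h1, h2⟩), sub_eq_add_neg,
        ← Finset.sum_neg_distrib]
      congr 1
      refine Finset.sum_congr rfl fun S hS => ?_
      rw [Finset.card_insert_of_notMem fun h => hp' (Finset.mem_powerset.1 hS h)]
      ring

lemma Laplace_apply {R : Type*} [CommRing R] (x : GS R n k) (H : DG n k) :
    Laplace n k x H = if ∃ p, (H p).1 = (H p).2 then 0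
        else ∑ S : Finset (Fin k), (-1 : R) ^ S.card * x (loopify H S) := by
  rw [Laplace, List.ofFn_eq_map, prod_B_apply _ (List.nodup_finRange k)]
  simp

lemma U_apply {R : Type*} [CommRing R] (P : DG n k → Prop) (H : DG n k) :
    U R n k P H = if P H then 1 else 0 := by
  rw [U, Finsupp.finsetSum_apply, Finset.sum_eq_single H]
  · split_ifs <;> simp
  · intro G _ hG
    split_ifs <;> simp [hG]
  · simp

lemma X_apply {R : Type*} [CommRing R] (P : DG n k → Prop) (H : DG n k) :
    X R n k P H = if P H then (-1) ^ beta0 H Finset.univ else 0 := by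
  rw [X, Finsupp.finsetSum_apply, Finset.sum_eq_single H]
  · split_ifs <;> simp
  · intro G _ hG
    split_ifs <;> simp [hG]
  · simp

/-- The labels in `Fin.cons e G` of the edges of `G` with labels outside `S`. -/
def succCompl (S : Finset (Fin k)) : Finset (Fin (k + 1)) :=
  Sᶜ.map (Fin.succEmb k)

lemma mem_succCompl {S : Finset (Fin k)} {p : Fin k} : p.succ ∈ succCompl S ↔ p ∉ S := by
  simp [succCompl]

lemma zero_notMem_succCompl (S : Finset (Fin k)) : 0 ∉ succCompl S := by
  simp [succCompl, Fin.succ_ne_zero]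

lemma card_succCompl (S : Finset (Fin k)) : (succCompl S).card + S.card = k := by
  rw [succCompl, Finset.card_map, Finset.card_compl_add_card, Fintype.card_fin]

lemma beta0_loopify (G : DG n k) (S : Finset (Fin k)) (e : Fin n × Fin n) :
    beta0 (loopify G S) Finset.univ = beta0 (Fin.cons e G : DG n (k + 1)) (succCompl S) := by
  refine card_quot_congr ?_ ?_
  · rintro a b ⟨p, -, h⟩
    by_cases hp : p ∈ S
    · have : a = b := by
        simp only [loopify, hp, if_true, Prod.mk.injEq] at h
        grind
      rw [this]
      exact .refl _
    · simp only [loopify, hp, if_false] at h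
      exact .rel _ _ ⟨p.succ, mem_succCompl.2 hp, by simpa using h⟩
  · rintro a b ⟨p, hp, h⟩
    cases p using Fin.cases with
    | zero => exact absurd hp (zero_notMem_succCompl S)
    | succ p =>
      have hp := mem_succCompl.1 hp
      exact .rel _ _ ⟨p, Finset.mem_univ p, by simpa [loopify, hp] using h⟩

lemma reflTransGen_cons_loopify {G : DG n k} {S : Finset (Fin k)} {e : Fin n × Fin n}
    {a b : Fin n} :
    Relation.ReflTransGen (step (Fin.cons e (loopify G S) : DG n (k + 1)) Finset.univ) a b ↔
      Relation.ReflTransGen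
        (step (Fin.cons e G : DG n (k + 1)) (insert 0 (succCompl S))) a b := by
  constructor
  · intro h
    induction h with
    | refl => exact .refl
    | @tail x y _ hxy ih =>
      obtain ⟨p, -, h⟩ := hxy
      cases p using Fin.cases with
      | zero => exact ih.tail ⟨0, by simp, by simpa using h⟩
      | succ p =>
        by_cases hp : p ∈ S
        · have : x = y := by
            simp only [Fin.cons_succ, loopify, hp, if_true, Prod.mk.injEq] at h
            grind
          exact this ▸ ih
        · exact ih.tail ⟨p.succ, by simp [mem_succCompl, hp], by simpa [loopify, hp] using h⟩
  · apply Relation.ReflTransGen.mono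
    rintro x y ⟨p, hp, h⟩
    refine ⟨p, Finset.mem_univ p, ?_⟩
    cases p using Fin.cases with
    | zero => simpa using h
    | succ p =>
      have hp : p ∉ S := by simpa [mem_succCompl] using hp
      simpa [loopify, hp] using h

lemma SSC_cons_loopify {G : DG n k} {S : Finset (Fin k)} {e : Fin n × Fin n} :
    SSC (Fin.cons e (loopify G S) : DG n (k + 1)) Finset.univ ↔
      SSC (Fin.cons e G : DG n (k + 1)) (insert 0 (succCompl S)) := by
  simp only [SSC, OnCycle, reflTransGen_cons_loopify]
  constructor
  · intro h p hp
    have := h p (Finset.mem_univ p)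
    cases p using Fin.cases with
    | zero => simpa using this
    | succ p =>
      have hp : p ∉ S := by simpa [mem_succCompl] using hp
      simpa [loopify, hp] using this
  · intro h p _
    cases p using Fin.cases with
    | zero => simpa using h 0 (by simp)
    | succ p =>
      by_cases hp : p ∈ S
      · simp [loopify, hp, Relation.ReflTransGen.refl]
      · simpa [loopify, hp] using h p.succ (by simp [mem_succCompl, hp])

lemma SSC.exists_out {G : DG n k} {E : Finset (Fin k)} (h : SSC G E) {e : Fin k} (he : e ∈ E) :
    ∃ f ∈ E, (G f).1 = (G e).2 := by
  rcases Relation.ReflTransGen.cases_head (h e he) with h' | ⟨x, ⟨f, hf, hfx⟩, -⟩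
  · exact ⟨e, he, h'.symm⟩
  · exact ⟨f, hf, by rw [hfx]⟩

lemma SSCset_cons_loopify {G : DG n k} {S : Finset (Fin k)} {i j : Fin n} :
    SSCset n (k + 1) ∅ (Fin.cons (i, j) (loopify G S)) ↔
      (∀ v, isSink G v → v = i) ∧
        SSC (Fin.cons (i, j) G : DG n (k + 1)) (insert 0 (succCompl S)) := by
  rw [SSCset, SSC_cons_loopify, and_comm]
  refine and_congr_left fun hS => ?_
  have hsrc : ∀ p, (loopify G S p).1 = (G p).1 := fun p => by
    simp only [loopify]
    split_ifs <;> rfl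
  rw [Finset.coe_empty, Set.eq_empty_iff_forall_notMem]
  refine forall_congr' fun v => ?_
  rw [Set.mem_ofPred_eq, isolated, Fin.forall_fin_succ]
  simp only [Fin.cons_zero, Fin.cons_succ]
  constructor
  · intro h hv
    by_contra hvi
    have hout : ∀ p ∈ insert 0 (succCompl S),
        ((Fin.cons (i, j) G : DG n (k + 1)) p).1 ≠ v := by
      intro p _
      cases p using Fin.cases with
      | zero => simpa using Ne.symm hvi
      | succ p => simpa using hv p
    have hin : ∀ p ∈ insert 0 (succCompl S),
        ((Fin.cons (i, j) G : DG n (k + 1)) p).2 ≠ v := by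
      intro p hp hpv
      obtain ⟨f, hf, hfv⟩ := hS.exists_out hp
      exact hout f hf (hfv.trans hpv)
    refine h ⟨⟨Ne.symm hvi, by simpa using hin 0 (by simp)⟩, fun p => ⟨?_, ?_⟩⟩
    · rw [hsrc]
      exact hv p
    · by_cases hp : p ∈ S
      · simpa [loopify, hp] using hv p
      · simpa [loopify, hp] using hin p.succ (by simp [mem_succCompl, hp])
  · rintro h ⟨⟨hiv, -⟩, hiso⟩
    exact hiv (h fun p => hsrc p ▸ (hiso p).1).symm

/-- From every vertex of an acyclic graph one can reach a sink. -/
lemma Acyclic.exists_reachable_sink {G : DG n k} (hG : Acyclic G Finset.univ) (a : Fin n) :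
    ∃ v, isSink G v ∧ Relation.ReflTransGen (step G Finset.univ) a v := by
  obtain ⟨v, hv, hs⟩ := hG.exists_sink
    (c := Finset.univ.filter fun v => Relation.ReflTransGen (step G Finset.univ) a v)
    ⟨a, by simp [Relation.ReflTransGen.refl]⟩ (fun e he h => by
      simp only [Finset.mem_filter, Finset.mem_univ, true_and] at h ⊢
      exact h.tail ⟨e, he, rfl⟩)
  exact ⟨v, fun e => hs e (Finset.mem_univ e), by simpa using hv⟩

lemma step_cons (G : DG n k) (e : Fin n × Fin n) :
    step (Fin.cons e G : DG n (k + 1)) (succCompl ∅) = step G Finset.univ := by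
  funext a b
  simp [step, succCompl, Fin.exists_fin_succ]

lemma Acyclic.no_loop {G : DG n k} (hG : Acyclic G Finset.univ) (p : Fin k) :
    (G p).1 ≠ (G p).2 := fun h =>
  hG (G p).1 (.single ⟨p, Finset.mem_univ p, Prod.ext rfl h.symm⟩)

lemma ACset_singleton_iff {G : DG n k} {i : Fin n} :
    ACset n k {i} G ↔ Acyclic G Finset.univ ∧ ∀ v, isSink G v → v = i := by
  refine and_congr_right fun hG => ?_
  rw [Finset.coe_singleton, Set.eq_singleton_iff_unique_mem]
  refine and_iff_right_of_imp fun h => ?_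
  obtain ⟨v, hv, -⟩ := hG.exists_reachable_sink i
  exact h v hv ▸ hv

lemma sum_succCompl (f : Finset (Fin (k + 1)) → ℤ) :
    ∑ S : Finset (Fin k), f (succCompl S)
      = ∑ T ∈ (succCompl (∅ : Finset (Fin k))).powerset, f T := by
  refine Finset.sum_nbij succCompl ?_ ?_ ?_ fun _ _ => rfl
  · intro S _
    rw [Finset.mem_powerset]
    exact Finset.map_subset_map.2 (Finset.compl_subset_compl.2 (Finset.empty_subset S))
  · intro S _ T _ h
    exact compl_injective (Finset.map_injective _ h)
  · intro T hT
    have hT := Finset.mem_powerset.1 (Finset.mem_coe.1 hT)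
    refine ⟨Finset.univ.filter fun p : Fin k => p.succ ∉ T, by simp, ?_⟩
    ext p
    cases p using Fin.cases with
    | zero => simpa [zero_notMem_succCompl] using fun h => zero_notMem_succCompl _ (hT h)
    | succ p => simp [mem_succCompl]

lemma sum_loopify (H : DG n k) (i j : Fin n) :
    ∑ S : Finset (Fin k), (-1 : ℤ) ^ S.card *
        (if SSCset n (k + 1) ∅ (Fin.cons (i, j) (loopify H S)) then
          (-1) ^ beta0 (loopify H S) Finset.univ else 0)
      = (-1) ^ (n + k) * if ACset n k {i} H then 1 else 0 := by
  simp only [ACset_singleton_iff, SSCset_cons_loopify, beta0_loopify H _ (i, j)]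
  by_cases hs : ∀ v, isSink H v → v = i
  · simp only [iff_true_intro hs, true_and, and_true]
    have hterm : ∀ S : Finset (Fin k), (-1 : ℤ) ^ S.card *
        (if SSC (Fin.cons (i, j) H : DG n (k + 1)) (insert 0 (succCompl S)) then
          (-1) ^ beta0 (Fin.cons (i, j) H : DG n (k + 1)) (succCompl S) else 0)
        = (-1) ^ (n + k) *
          (if SSC (Fin.cons (i, j) H : DG n (k + 1)) (insert 0 (succCompl S)) then
            (-1) ^ ((succCompl S).card + n +
              beta0 (Fin.cons (i, j) H : DG n (k + 1)) (succCompl S)) else 0) := by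
      intro S
      split_ifs
      · have hk : (-1 : ℤ) ^ k = (-1) ^ (succCompl S).card * (-1) ^ S.card := by
          rw [← pow_add, card_succCompl]
        have h2 : ∀ m : ℕ, (-1 : ℤ) ^ m * (-1) ^ m = 1 := fun m => by
          rw [← mul_pow]
          simp
        rw [pow_add, pow_add, pow_add, hk]
        linear_combination (-(-1 : ℤ) ^ S.card *
          (-1) ^ beta0 (Fin.cons (i, j) H : DG n (k + 1)) (succCompl S)) *
          ((-1) ^ n * (-1) ^ n * h2 (succCompl S).card + h2 n)
      · simp
    rw [Finset.sum_congr rfl fun S _ => hterm S, ← Finset.mul_sum,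
      sum_succCompl fun T => if SSC (Fin.cons (i, j) H : DG n (k + 1)) (insert 0 T) then
        (-1) ^ (T.card + n + beta0 (Fin.cons (i, j) H : DG n (k + 1)) T) else 0,
      sum_SSC_insert _ (zero_notMem_succCompl _), acyclic_insert_iff, Acyclic, step_cons,
      Fin.cons_zero, ← Acyclic]
    congr 1
    by_cases hA : Acyclic H Finset.univ
    · obtain ⟨v, hv, hjv⟩ := hA.exists_reachable_sink j
      rw [hs v hv] at hjv
      simp [hA, hjv]
    · simp [hA]
  · simp [hs]

end DG

/-- abstract matrix-tree theorem for codimension-1 minors.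
`Δ(det_{n,k}^{i/j}) = ((−1)^n / k!) · U(AC_{n,k}^{{i}})` in `Graph_{n,k}`;
in particular the result is independent of `j`. -/
theorem laplace_detIJ (n k : ℕ) (hn : 1 ≤ n) (i j : Fin n) :
    DG.Laplace (R := ℂ) n k (DG.detIJ ℂ n k i j)
      = (((-1 : ℂ) ^ n) / (k ! : ℂ)) • DG.U ℂ n k (DG.ACset n k {i}) := by
  ext H
  have hcast := congrArg (Int.cast : ℤ → ℂ) (DG.sum_loopify H i j)
  push_cast at hcast
  simp only [DG.detIJ, map_smul, Finsupp.smul_apply, smul_eq_mul, DG.Laplace_apply, DG.U_apply,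
    DG.X_apply]
  split_ifs with hloop hA hA
  · obtain ⟨p, hp⟩ := hloop
    exact absurd hp (hA.1.no_loop p)
  · simp
  all_goals simp only [hcast, hA, if_true, if_false, mul_zero, mul_one]
  have hk : (-1 : ℂ) ^ k * (-1) ^ k = 1 := by
    rw [← mul_pow]
    simp
  rw [pow_add]
  linear_combination ((-1 : ℂ) ^ n / (k ! : ℂ)) * hk
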